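/- arXiv:2210.10215 — 3 statements merged into one kernel-verified Lean document; each statement's English description precedes it below -/
import Mathlib

section
/- For every integer n ≥ 0, the set of F_q[[T]]-submodules M of F_q[[T]]^d with dim_{F_q}(F_q[[T]]^d / M) = n is finite, and its cardinality equals Σ_{x ∈ ℕ^d, n(x) = n} q^{W(x)}. -/
namespace Spiral

/-- The size `n(x) = n₁ + ⋯ + n_d` of a configuration `x ∈ ℕ^d`. -/
def size {d : ℕ} (x : Fin d → ℕ) : ℕ := ∑ i, x i

/-- The weight `W(x) = Σ_{i<j} (max(0, x_j − x_i) + max(0, x_i − x_j − 1))`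
(truncated ℕ-subtraction realizes the `max(0,·)`). -/
def weight {d : ℕ} (x : Fin d → ℕ) : ℕ :=
  ∑ i : Fin d, ∑ j : Fin d, if i < j then (x j - x i) + (x i - x j - 1) else 0

end Spiral

namespace Spiral

section Aux

variable {d : ℕ} [NeZero d] {F : Type*} [Field F]

/-- The `k`-th coefficient of a vector of power series, in spiral order. -/
noncomputable def cf (k : ℕ) : (Fin d → PowerSeries F) →ₗ[F] F :=
  (PowerSeries.coeff (R := F) (k / d)) ∘ₗ (LinearMap.proj (Fin.ofNat d k))

lemma idx_div (b : ℕ) (i : Fin d) : (b * d + i.val) / d = b := by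
  have := i.pos
  rw [mul_comm, Nat.mul_add_div this, Nat.div_eq_of_lt i.isLt, add_zero]

lemma idx_mod (b : ℕ) (i : Fin d) : Fin.ofNat d (b * d + i.val) = i := by
  apply Fin.ext
  simp [Fin.ofNat, Nat.mod_eq_of_lt i.isLt]

lemma idx_eq (k : ℕ) : k / d * d + (Fin.ofNat d k).val = k := by
  simp only [Fin.ofNat]
  exact Nat.div_add_mod' k d

lemma cf_apply (k : ℕ) (v : Fin d → PowerSeries F) :
    cf k v = PowerSeries.coeff (k / d) (v (Fin.ofNat d k)) := rfl

lemma cf_idx (b : ℕ) (i : Fin d) (v : Fin d → PowerSeries F) :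
    cf (b * d + i.val) v = PowerSeries.coeff b (v i) := by
  rw [cf_apply, idx_div, idx_mod]

lemma cf_ext {v w : Fin d → PowerSeries F} (h : ∀ k, cf k v = cf k w) : v = w := by
  funext i
  ext b
  rw [← cf_idx, ← cf_idx, h]

/-- basis vectors -/
noncomputable def E (k : ℕ) : Fin d → PowerSeries F :=
  Pi.single (Fin.ofNat d k) (PowerSeries.X ^ (k / d))

lemma cf_E (k l : ℕ) : cf l (E (d := d) (F := F) k) = if l = k then 1 else 0 := by
  rw [cf_apply, E]
  by_cases h : Fin.ofNat d l = Fin.ofNat d k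
  · rw [h, Pi.single_eq_same, PowerSeries.coeff_X_pow]
    congr 1
    apply propext
    constructor
    · intro h'
      rw [← idx_eq (d := d) l, ← idx_eq (d := d) k, h, h']
    · rintro rfl; rfl
  · rw [Pi.single_eq_of_ne h, if_neg]
    · simp
    · rintro rfl; exact h rfl

/-- vectors of order at least `k` -/
noncomputable def Vge (d : ℕ) [NeZero d] (F : Type*) [Field F] (k : ℕ) :
    Submodule (PowerSeries F) (Fin d → PowerSeries F) where
  carrier := {v | ∀ l < k, cf l v = 0}
  add_mem' := by
    intro a b ha hb l hl
    rw [map_add, ha l hl, hb l hl, add_zero]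
  zero_mem' := by
    intro l _
    simp
  smul_mem' := by
    intro g v hv l hl
    rw [cf_apply, Pi.smul_apply, smul_eq_mul, PowerSeries.coeff_mul]
    apply Finset.sum_eq_zero
    rintro ⟨s, t⟩ hst
    rw [Finset.HasAntidiagonal.mem_antidiagonal] at hst
    simp only at hst ⊢
    rw [← cf_idx, hv, mul_zero]
    have h1 := idx_eq (d := d) l
    have h2 : t * d ≤ l / d * d := Nat.mul_le_mul_right _ (by omega)
    omega

lemma mem_Vge {k : ℕ} {v : Fin d → PowerSeries F} :
    v ∈ Vge d F k ↔ ∀ l < k, cf l v = 0 := Iff.rfl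

lemma Vge_anti {a b : ℕ} (h : a ≤ b) : Vge d F b ≤ Vge d F a :=
  fun _ hv l hl => hv l (by omega)

lemma Vge_zero (v : Fin d → PowerSeries F) : v ∈ Vge d F 0 := by
  intro l hl; omega

lemma cf_X_smul (l : ℕ) (m : ℕ) (v : Fin d → PowerSeries F) :
    cf (l + m * d) ((PowerSeries.X ^ m : PowerSeries F) • v) = cf l v := by
  have h : l + m * d = (l / d + m) * d + (Fin.ofNat d l).val := by
    have := idx_eq (d := d) l
    rw [add_mul]; omega
  rw [h, cf_idx, Pi.smul_apply, smul_eq_mul, PowerSeries.coeff_X_pow_mul, cf_apply]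

lemma X_smul_mem {k : ℕ} {v : Fin d → PowerSeries F} (m : ℕ) (hv : v ∈ Vge d F k) :
    (PowerSeries.X ^ m : PowerSeries F) • v ∈ Vge d F (k + m * d) := by
  intro l hl
  by_cases h : l < m * d
  · rw [cf_apply, Pi.smul_apply, smul_eq_mul, PowerSeries.coeff_X_pow_mul', if_neg]
    rw [not_le]
    exact Nat.div_lt_of_lt_mul (by rwa [mul_comm])
  · obtain ⟨l', rfl⟩ := Nat.exists_eq_add_of_le (not_lt.mp h)
    rw [add_comm, cf_X_smul]
    exact hv _ (by omega)

lemma exists_X_smul {k : ℕ} (m : ℕ) {v : Fin d → PowerSeries F} (hv : v ∈ Vge d F (k + m * d)) :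
    ∃ w ∈ Vge d F k, v = (PowerSeries.X ^ m : PowerSeries F) • w := by
  have key : v = (PowerSeries.X ^ m : PowerSeries F) •
      (fun i => PowerSeries.mk (fun a => PowerSeries.coeff (a + m) (v i))) := by
    funext i
    ext b
    rw [Pi.smul_apply, smul_eq_mul, PowerSeries.coeff_X_pow_mul']
    split_ifs with h
    · rw [PowerSeries.coeff_mk, Nat.sub_add_cancel h]
    · rw [← cf_idx]
      apply hv
      have : (b + 1) * d ≤ m * d := Nat.mul_le_mul_right _ (by omega)
      have := i.isLt
      rw [add_mul] at *
      omega
  refine ⟨_, ?_, key⟩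
  intro l hl
  rw [← cf_X_smul l m, ← key]
  exact hv _ (by omega)

/-- `v` has leading index `k`. -/
def Lead (v : Fin d → PowerSeries F) (k : ℕ) : Prop := v ∈ Vge d F k ∧ cf k v ≠ 0

lemma Lead.unique {v : Fin d → PowerSeries F} {k l : ℕ} (hk : Lead v k) (hl : Lead v l) :
    k = l := by
  rcases lt_trichotomy k l with h | h | h
  · exact absurd (hl.1 k h) hk.2
  · exact h
  · exact absurd (hk.1 l h) hl.2

lemma exists_lead {v : Fin d → PowerSeries F} (hv : v ≠ 0) : ∃ k, Lead v k := by
  classical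
  have h : ∃ k, cf k v ≠ 0 := by
    by_contra hcon
    push Not at hcon
    exact hv (cf_ext (fun k => by rw [hcon, map_zero]))
  refine ⟨Nat.find h, ?_, Nat.find_spec h⟩
  intro l hl
  have := Nat.find_min h hl
  simpa using this

lemma Lead.X_smul {v : Fin d → PowerSeries F} {k : ℕ} (m : ℕ) (h : Lead v k) :
    Lead ((PowerSeries.X ^ m : PowerSeries F) • v) (k + m * d) :=
  ⟨X_smul_mem m h.1, by rw [cf_X_smul]; exact h.2⟩

lemma lead_E (k : ℕ) : Lead (E (d := d) (F := F) k) k := by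
  constructor
  · intro l hl
    rw [cf_E, if_neg (by omega)]
  · rw [cf_E, if_pos rfl]; exact one_ne_zero

lemma mem_Vge_succ {v : Fin d → PowerSeries F} {k : ℕ} (h : v ∈ Vge d F k) (h0 : cf k v = 0) :
    v ∈ Vge d F (k + 1) := by
  intro l hl
  rcases Nat.lt_succ_iff_lt_or_eq.mp hl with h1 | rfl
  · exact h l h1
  · exact h0

lemma Vge_smul (c : F) {v : Fin d → PowerSeries F} {k : ℕ} (h : v ∈ Vge d F k) :
    c • v ∈ Vge d F k := by
  intro l hl
  rw [map_smul, h l hl, smul_zero]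

/-- finite reduction -/
lemma reduce (U : Submodule F (Fin d → PowerSeries F)) (a n : ℕ)
    (hU : ∀ k, a ≤ k → k < a + n → ∃ u ∈ U, Lead u k) (v : Fin d → PowerSeries F)
    (hv : v ∈ Vge d F a) : ∃ u ∈ U, v - u ∈ Vge d F (a + n) := by
  induction n with
  | zero => exact ⟨0, U.zero_mem, by simpa using hv⟩
  | succ n ih =>
    obtain ⟨u, hu, hvu⟩ := ih (fun k h1 h2 => hU k h1 (by omega))
    obtain ⟨w, hw, hl⟩ := hU (a + n) (by omega) (by omega)
    refine ⟨u + (cf (a + n) (v - u) / cf (a + n) w) • w, U.add_mem hu (U.smul_mem _ hw), ?_⟩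
    rw [← sub_sub]
    apply mem_Vge_succ
    · exact Submodule.sub_mem _ hvu (Vge_smul _ hl.1)
    · change cf (a + n) _ = 0
      rw [map_sub, map_smul, smul_eq_mul, div_mul_cancel₀ _ hl.2, sub_self]

/-- leading index of `g • v` -/
lemma Lead.smul {v : Fin d → PowerSeries F} {k : ℕ} (h : Lead v k) {g : PowerSeries F}
    (hg : g ≠ 0) : ∃ m, Lead (g • v) (k + m * d) := by
  obtain ⟨m, u, hu, rfl⟩ : ∃ m, ∃ u : PowerSeries F, PowerSeries.constantCoeff u ≠ 0 ∧
      g = PowerSeries.X ^ m * u := by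
    refine ⟨g.order.toNat, g.divXPowOrder, ?_, (PowerSeries.X_pow_order_mul_divXPowOrder).symm⟩
    rw [PowerSeries.constantCoeff_divXPowOrder]
    exact PowerSeries.coeff_order hg
  refine ⟨m, ?_⟩
  rw [mul_smul]
  apply Lead.X_smul
  refine ⟨Submodule.smul_mem _ _ h.1, ?_⟩
  rw [cf_apply, Pi.smul_apply, smul_eq_mul, PowerSeries.coeff_mul]
  rw [Finset.sum_eq_single (0, k / d)]
  · rw [PowerSeries.coeff_zero_eq_constantCoeff_apply, ← cf_apply]
    exact mul_ne_zero hu h.2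
  · rintro ⟨s, t⟩ hst hne
    rw [Finset.HasAntidiagonal.mem_antidiagonal] at hst
    simp only at hst ⊢
    have hs : s ≠ 0 := by
      rintro rfl
      apply hne
      rw [← hst]; simp
    rw [← cf_idx, h.1, mul_zero]
    have h1 := idx_eq (d := d) k
    have h2 : (t + 1) * d ≤ k / d * d := Nat.mul_le_mul_right _ (by omega)
    have := NeZero.pos d
    rw [add_mul] at h2
    omega
  · intro hn
    simp at hn

/-- The leading indices of `M` are those described by `x`. -/
def Has (M : Submodule (PowerSeries F) (Fin d → PowerSeries F)) (x : Fin d → ℕ) : Prop :=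
  ∀ k, (∃ v ∈ M, Lead v k) ↔ x (Fin.ofNat d k) ≤ k / d

lemma Has.unique {M : Submodule (PowerSeries F) (Fin d → PowerSeries F)} {x y : Fin d → ℕ}
    (hx : Has M x) (hy : Has M y) : x = y := by
  funext i
  have h : ∀ b, x i ≤ b ↔ y i ≤ b := by
    intro b
    have h1 := hx (b * d + i.val)
    have h2 := hy (b * d + i.val)
    rw [idx_div, idx_mod] at h1 h2
    rw [← h1, h2]
  exact le_antisymm ((h _).2 le_rfl) ((h _).1 le_rfl)

lemma lead_up {M : Submodule (PowerSeries F) (Fin d → PowerSeries F)} {i : Fin d} {b c : ℕ}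
    (hbc : b ≤ c) (h : ∃ v ∈ M, Lead v (b * d + i.val)) : ∃ v ∈ M, Lead v (c * d + i.val) := by
  obtain ⟨v, hv, hl⟩ := h
  refine ⟨_, M.smul_mem (PowerSeries.X ^ (c - b)) hv, ?_⟩
  convert hl.X_smul (c - b) using 1
  obtain ⟨e, rfl⟩ := Nat.exists_eq_add_of_le hbc
  simp only [Nat.add_sub_cancel_left]
  ring

lemma exists_has (M : Submodule (PowerSeries F) (Fin d → PowerSeries F))
    (hM : Module.Finite F ((Fin d → PowerSeries F) ⧸ M)) : ∃ x, Has M x := by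
  classical
  have h : ∀ i : Fin d, ∃ b, ∃ v ∈ M, Lead v (b * d + i.val) := by
    intro i
    have hnl : ¬ LinearIndependent F
        (fun b : ℕ => (Submodule.Quotient.mk (E (d := d) (F := F) (b * d + i.val)) :
          (Fin d → PowerSeries F) ⧸ M)) := by
      intro hli
      have := hli.finite
      exact not_finite ℕ
    rw [not_linearIndependent_iff] at hnl
    obtain ⟨s, g, hs, b0, hb0, hg⟩ := hnl
    have hmem : ∑ b ∈ s, g b • E (d := d) (F := F) (b * d + i.val) ∈ M := by
      rw [← Submodule.Quotient.mk_eq_zero, ← hs]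
      simp only [← Submodule.mkQ_apply, map_sum]
      rfl
    have hcf : ∀ k, cf k (∑ b ∈ s, g b • E (d := d) (F := F) (b * d + i.val)) =
        ∑ b ∈ s, g b * (if k = b * d + i.val then 1 else 0) := by
      intro k
      rw [map_sum]
      apply Finset.sum_congr rfl
      intro b _
      rw [map_smul, cf_E, smul_eq_mul]
    have hne : ∑ b ∈ s, g b • E (d := d) (F := F) (b * d + i.val) ≠ 0 := by
      intro h0
      have h1 := hcf (b0 * d + i.val)
      rw [h0, map_zero, Finset.sum_eq_single b0] at h1
      · simp at h1; exact hg h1.symm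
      · intro b _ hb
        rw [if_neg, mul_zero]
        intro h2
        have := congrArg (· / d) h2
        simp only [idx_div] at this
        exact hb this.symm
      · intro h; exact absurd hb0 h
    obtain ⟨k, hk⟩ := exists_lead hne
    have : ∃ b, k = b * d + i.val := by
      by_contra hcon
      push Not at hcon
      apply hk.2
      rw [hcf]
      apply Finset.sum_eq_zero
      intro b _
      rw [if_neg (hcon b), mul_zero]
    obtain ⟨b, rfl⟩ := this
    exact ⟨b, _, hmem, hk⟩
  refine ⟨fun i => Nat.find (h i), ?_⟩
  intro k
  have hk := idx_eq (d := d) k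
  constructor
  · intro hv
    apply Nat.find_min'
    rwa [hk]
  · intro hle
    have := lead_up hle (Nat.find_spec (h (Fin.ofNat d k)))
    rwa [hk] at this

lemma Has.exists_Vge_le {M : Submodule (PowerSeries F) (Fin d → PowerSeries F)} {x : Fin d → ℕ}
    (h : Has M x) : ∃ K, Vge d F (K * d) ≤ M := by
  classical
  obtain ⟨K, hK⟩ : ∃ K, ∀ i, x i ≤ K := ⟨∑ i, x i, fun i =>
    Finset.single_le_sum (f := x) (fun _ _ => Nat.zero_le _) (Finset.mem_univ i)⟩
  refine ⟨K, ?_⟩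
  apply Submodule.le_of_le_smul_of_le_jacobson_bot (I := Ideal.span {PowerSeries.X})
  · exact IsNoetherian.noetherian _
  · rw [IsLocalRing.jacobson_eq_maximalIdeal _ bot_ne_top, Ideal.span_le,
      Set.singleton_subset_iff, SetLike.mem_coe, IsLocalRing.mem_maximalIdeal, mem_nonunits_iff]
    exact PowerSeries.X_prime.not_isUnit
  · intro v hv
    obtain ⟨u, hu, hvu⟩ := reduce (M.restrictScalars F) (K * d) d (by
      intro k h1 _
      have h2 : K ≤ k / d := (Nat.le_div_iff_mul_le (NeZero.pos d)).2 h1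
      exact (h k).2 ((hK _).trans h2)) v hv
    obtain ⟨w, hw, hvw⟩ := exists_X_smul (k := K * d) 1 (by simpa using hvu)
    rw [pow_one] at hvw
    rw [← add_sub_cancel u v, hvw]
    refine Submodule.add_mem_sup (S := M) hu ?_
    exact Submodule.smul_mem_smul (Ideal.mem_span_singleton_self _) hw

/-- vectors supported on `S` -/
noncomputable def Psub (d : ℕ) [NeZero d] (F : Type*) [Field F] (S : Finset ℕ) :
    Submodule F (Fin d → PowerSeries F) where
  carrier := {v | ∀ k, k ∉ S → cf k v = 0}
  add_mem' := by
    intro a b ha hb l hl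
    rw [map_add, ha l hl, hb l hl, add_zero]
  zero_mem' := by
    intro l _
    simp
  smul_mem' := by
    intro g v hv l hl
    rw [map_smul, hv l hl, smul_zero]

lemma E_mem_Psub {S : Finset ℕ} {k : ℕ} (hk : k ∈ S) : E k ∈ Psub d F S := by
  intro l hl
  rw [cf_E, if_neg]
  rintro rfl; exact hl hk

lemma Psub_mono {S T : Finset ℕ} (h : S ⊆ T) : Psub d F S ≤ Psub d F T :=
  fun _ hv k hk => hv k (fun hS => hk (h hS))

/-- coordinates on `Psub` -/
noncomputable def PEquiv (S : Finset ℕ) : Psub d F S ≃ₗ[F] (S → F) :=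
  LinearEquiv.ofBijective
    ((LinearMap.pi (fun k : S => cf (k : ℕ))) ∘ₗ (Psub d F S).subtype) (by
    constructor
    · rw [injective_iff_map_eq_zero]
      rintro ⟨v, hv⟩ h
      apply Subtype.ext
      apply cf_ext
      intro k
      by_cases hk : k ∈ S
      · have := congrFun h ⟨k, hk⟩
        simpa using this
      · simpa using hv k hk
    · intro g
      refine ⟨⟨∑ k : S, g k • E (k : ℕ), Submodule.sum_mem _ fun k _ =>
        Submodule.smul_mem _ _ (E_mem_Psub k.2)⟩, ?_⟩
      funext l
      simp only [LinearMap.comp_apply, Submodule.subtype_apply, LinearMap.pi_apply, map_sum,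
        map_smul, cf_E, smul_eq_mul]
      rw [Finset.sum_eq_single l]
      · simp
      · intro b _ hb
        rw [if_neg, mul_zero]
        intro h; exact hb (Subtype.ext h.symm)
      · simp)

lemma finrank_Psub (S : Finset ℕ) : Module.finrank F (Psub d F S) = S.card := by
  rw [(PEquiv S).finrank_eq]; simp

lemma finite_Psub (S : Finset ℕ) : Module.Finite F (Psub d F S) :=
  Module.Finite.equiv (PEquiv S).symm

lemma card_Psub [Fintype F] (S : Finset ℕ) :
    Nat.card (Psub d F S) = Fintype.card F ^ S.card := by
  rw [Nat.card_congr (PEquiv S).toEquiv]; simp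

/-- the gaps of `x` -/
def gaps (x : Fin d → ℕ) : Finset ℕ :=
  (Finset.univ.sigma (fun i => Finset.range (x i))).image
    (fun p : (_ : Fin d) × ℕ => p.2 * d + p.1.val)

lemma mem_gaps {x : Fin d → ℕ} {k : ℕ} : k ∈ gaps x ↔ k / d < x (Fin.ofNat d k) := by
  unfold gaps
  simp only [Finset.mem_image, Finset.mem_sigma, Finset.mem_univ, true_and, Finset.mem_range,
    Sigma.exists]
  constructor
  · rintro ⟨i, b, hb, rfl⟩
    rwa [idx_div, idx_mod]
  · intro h
    exact ⟨_, _, h, idx_eq k⟩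

lemma idx_inj : Function.Injective (fun p : (_ : Fin d) × ℕ => p.2 * d + p.1.val) := by
  rintro ⟨i, b⟩ ⟨j, c⟩ h
  simp only at h
  have h1 : b = c := by rw [← idx_div b i, h, idx_div]
  have h2 : i = j := by rw [← idx_mod b i, h, idx_mod]
  rw [h1, h2]

lemma card_gaps (x : Fin d → ℕ) : (gaps x).card = ∑ i, x i := by
  rw [gaps, Finset.card_image_of_injective _ idx_inj, Finset.card_sigma]
  simp

/-- the gaps beyond the `j`-th generator -/
def bigGaps (x : Fin d → ℕ) (j : Fin d) : Finset ℕ :=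
  (gaps x).filter (fun k => x j * d + j.val < k)

lemma card_bigGaps (x : Fin d → ℕ) (j : Fin d) : (bigGaps x j).card =
    ∑ i, ((if j < i then x i - x j else 0) + (if i < j then x i - x j - 1 else 0)) := by
  rw [bigGaps, gaps, Finset.filter_image, Finset.card_image_of_injective _ idx_inj,
    Finset.card_filter, Finset.sum_sigma]
  apply Finset.sum_congr rfl
  intro i _
  rw [← Finset.card_filter]
  simp only
  have hi := i.isLt
  have hj := j.isLt
  have hlex : ∀ b, x j * d + j.val < b * d + i.val ↔ x j < b ∨ (x j = b ∧ j < i) := by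
    intro b
    rw [Fin.lt_def]
    rcases lt_trichotomy (x j) b with h | h | h
    · have : (x j + 1) * d ≤ b * d := Nat.mul_le_mul_right _ h
      rw [add_mul] at this
      omega
    · subst h; omega
    · have : (b + 1) * d ≤ x j * d := Nat.mul_le_mul_right _ h
      rw [add_mul] at this
      omega
  simp only [hlex]
  rcases lt_trichotomy j i with h | h | h
  · rw [if_pos h, if_neg (not_lt.2 h.le), add_zero]
    rw [← Nat.card_Ico]
    congr 1
    ext b
    simp only [Finset.mem_filter, Finset.mem_range, Finset.mem_Ico, h, and_true]
    omega
  · subst h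
    simp only [lt_irrefl, if_false, and_false, or_false, add_zero]
    rw [Finset.card_eq_zero, Finset.filter_eq_empty_iff]
    intro b hb
    rw [Finset.mem_range] at hb
    omega
  · rw [if_pos h, if_neg (not_lt.2 h.le), zero_add]
    rw [Nat.sub_sub, ← Nat.card_Ico]
    congr 1
    ext b
    simp only [Finset.mem_filter, Finset.mem_range, Finset.mem_Ico, not_lt.2 h.le, and_false,
      or_false]
    omega

lemma sum_card_bigGaps (x : Fin d → ℕ) : ∑ j, (bigGaps x j).card = weight x := by
  simp only [card_bigGaps, Finset.sum_add_distrib]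
  rw [Finset.sum_comm (f := fun j i : Fin d => if i < j then x i - x j - 1 else 0)]
  unfold weight
  rw [← Finset.sum_add_distrib]
  apply Finset.sum_congr rfl
  intro i _
  rw [← Finset.sum_add_distrib]
  apply Finset.sum_congr rfl
  intro j _
  split_ifs <;> simp

lemma Has.decomp {M : Submodule (PowerSeries F) (Fin d → PowerSeries F)} {x : Fin d → ℕ}
    (h : Has M x) (a : ℕ) (v : Fin d → PowerSeries F) (hv : v ∈ Vge d F a) :
    ∃ m ∈ M, ∃ p ∈ Psub d F (gaps x), p ∈ Vge d F a ∧ m + p = v := by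
  obtain ⟨K, hK⟩ := h.exists_Vge_le
  obtain ⟨u, hu, hvu⟩ := reduce
    (M.restrictScalars F ⊔ (Psub d F (gaps x) ⊓ (Vge d F a).restrictScalars F)) a (K * d) (by
      intro k hk _
      by_cases hg : k ∈ gaps x
      · exact ⟨E k, Submodule.mem_sup_right ⟨E_mem_Psub hg, Vge_anti hk (lead_E k).1⟩, lead_E k⟩
      · rw [mem_gaps, not_lt] at hg
        obtain ⟨w, hw, hl⟩ := (h k).2 hg
        exact ⟨w, Submodule.mem_sup_left hw, hl⟩) v hv
  obtain ⟨m, hm, p, hp, rfl⟩ := Submodule.mem_sup.1 hu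
  refine ⟨m + (v - (m + p)), M.add_mem hm (hK (Vge_anti (by omega) hvu)), p, hp.1, hp.2, ?_⟩
  abel

lemma Has.isCompl {M : Submodule (PowerSeries F) (Fin d → PowerSeries F)} {x : Fin d → ℕ}
    (h : Has M x) : IsCompl (M.restrictScalars F) (Psub d F (gaps x)) := by
  constructor
  · rw [Submodule.disjoint_def]
    intro v hv hp
    by_contra hne
    obtain ⟨k, hk⟩ := exists_lead hne
    apply hk.2
    apply hp
    rw [mem_gaps, not_lt]
    exact (h k).1 ⟨v, hv, hk⟩
  · rw [codisjoint_iff, Submodule.eq_top_iff']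
    intro v
    obtain ⟨m, hm, p, hp, -, rfl⟩ := h.decomp 0 v (Vge_zero v)
    exact Submodule.add_mem_sup hm hp

lemma Has.finrank {M : Submodule (PowerSeries F) (Fin d → PowerSeries F)} {x : Fin d → ℕ}
    (h : Has M x) : Module.Finite F ((Fin d → PowerSeries F) ⧸ M) ∧
      Module.finrank F ((Fin d → PowerSeries F) ⧸ M) = ∑ i, x i := by
  let e : ((Fin d → PowerSeries F) ⧸ M) ≃ₗ[F] Psub d F (gaps x) :=
    (Submodule.Quotient.restrictScalarsEquiv F M).symm ≪≫ₗ
      Submodule.quotientEquivOfIsCompl _ _ h.isCompl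
  have := finite_Psub (d := d) (F := F) (gaps x)
  refine ⟨Module.Finite.equiv e.symm, ?_⟩
  rw [e.finrank_eq, finrank_Psub, card_gaps]

lemma Has.eq_of_le {M N : Submodule (PowerSeries F) (Fin d → PowerSeries F)} {x : Fin d → ℕ}
    (hM : Has M x) (hN : Has N x) (hle : M ≤ N) : M = N := by
  apply le_antisymm hle
  intro v hv
  obtain ⟨m, hm, p, hp, -, rfl⟩ := hM.decomp 0 v (Vge_zero v)
  have hpN : p ∈ N := by simpa using N.sub_mem hv (hle hm)
  have := Submodule.disjoint_def.1 hN.isCompl.disjoint p hpN hp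
  rw [this, add_zero]; exact hm

/-- generators -/
noncomputable def gen (x : Fin d → ℕ) (p : ∀ j, Psub d F (bigGaps x j)) (j : Fin d) :
    Fin d → PowerSeries F := E (x j * d + j.val) + (p j : Fin d → PowerSeries F)

lemma bigGaps_Vge {x : Fin d → ℕ} {j : Fin d} {p : Fin d → PowerSeries F}
    (hp : p ∈ Psub d F (bigGaps x j)) : p ∈ Vge d F (x j * d + j.val + 1) := by
  intro l hl
  apply hp
  intro hmem
  have := (Finset.mem_filter.1 hmem).2
  omega

lemma lead_gen (x : Fin d → ℕ) (p : ∀ j, Psub d F (bigGaps x j)) (j : Fin d) :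
    Lead (gen x p j) (x j * d + j.val) := by
  have h := bigGaps_Vge (p j).2
  constructor
  · exact Submodule.add_mem _ (lead_E _).1 (Vge_anti (by omega) h)
  · rw [gen, map_add, h _ (by omega), add_zero]
    exact (lead_E _).2

/-- the module of a parameter -/
noncomputable def Phi (x : Fin d → ℕ) (p : ∀ j, Psub d F (bigGaps x j)) :
    Submodule (PowerSeries F) (Fin d → PowerSeries F) :=
  Submodule.span _ (Set.range (gen x p))

lemma gen_mem (x : Fin d → ℕ) (p : ∀ j, Psub d F (bigGaps x j)) (j : Fin d) :
    gen x p j ∈ Phi x p := Submodule.subset_span ⟨j, rfl⟩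

lemma has_Phi (x : Fin d → ℕ) (p : ∀ j, Psub d F (bigGaps x j)) : Has (Phi x p) x := by
  classical
  intro k
  constructor
  · rintro ⟨v, hv, hl⟩
    obtain ⟨g, rfl⟩ := (Submodule.mem_span_range_iff_exists_fun _).1 hv
    have hm : ∀ j, ∃ m, g j ≠ 0 → Lead (g j • gen x p j) (x j * d + j.val + m * d) := by
      intro j
      by_cases hg : g j = 0
      · exact ⟨0, fun h => absurd hg h⟩
      · obtain ⟨m, hm⟩ := (lead_gen x p j).smul hg
        exact ⟨m, fun _ => hm⟩
    choose m hm using hm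
    have hne : (Finset.univ.filter (fun j => g j ≠ 0)).Nonempty := by
      by_contra hcon
      rw [Finset.not_nonempty_iff_eq_empty, Finset.filter_eq_empty_iff] at hcon
      apply hl.2
      rw [Finset.sum_eq_zero, map_zero]
      intro j hj
      have := hcon hj
      rw [not_not] at this
      rw [this, zero_smul]
    obtain ⟨j, hj, hmin⟩ := Finset.exists_min_image _ (fun j => x j * d + j.val + m j * d) hne
    have hgj := (Finset.mem_filter.1 hj).2
    have hidx : ∀ i, x i * d + i.val + m i * d = (x i + m i) * d + i.val := by
      intro i; ring
    have hlead : Lead (∑ i, g i • gen x p i) (x j * d + j.val + m j * d) := by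
      constructor
      · apply Submodule.sum_mem
        intro i _
        by_cases hg : g i = 0
        · rw [hg, zero_smul]; exact Submodule.zero_mem _
        · exact Vge_anti (hmin i (Finset.mem_filter.2 ⟨Finset.mem_univ _, hg⟩)) (hm i hg).1
      · rw [map_sum, Finset.sum_eq_single j]
        · exact (hm j hgj).2
        · intro i _ hij
          by_cases hg : g i = 0
          · rw [hg, zero_smul, map_zero]
          · have h1 := hmin i (Finset.mem_filter.2 ⟨Finset.mem_univ _, hg⟩)
            apply (hm i hg).1
            apply lt_of_le_of_ne h1
            rw [hidx, hidx]
            intro h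
            apply hij
            rw [← idx_mod (x i + m i) i, ← h, idx_mod]
        · intro h; exact absurd (Finset.mem_univ _) h
    rw [hl.unique hlead, hidx, idx_div, idx_mod]
    omega
  · intro hle
    have := lead_up hle ⟨_, gen_mem x p _, lead_gen x p (Fin.ofNat d k)⟩
    rwa [idx_eq] at this

lemma Phi_injective (x : Fin d → ℕ) : Function.Injective (Phi (F := F) x) := by
  intro p p' h
  funext j
  apply Subtype.ext
  have h1 := gen_mem x p j
  have h2 := gen_mem x p' j
  rw [← h] at h2
  have h3 := (Phi x p).sub_mem h1 h2
  rw [gen, gen, add_sub_add_left_eq_sub] at h3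
  rw [← sub_eq_zero]
  refine Submodule.disjoint_def.1 (has_Phi x p).isCompl.disjoint _ h3 ?_
  exact Submodule.sub_mem _ (Psub_mono (Finset.filter_subset _ _) (p j).2)
    (Psub_mono (Finset.filter_subset _ _) (p' j).2)

lemma Phi_surjective (x : Fin d → ℕ) (M : Submodule (PowerSeries F) (Fin d → PowerSeries F))
    (hM : Has M x) : ∃ p, Phi x p = M := by
  have hex : ∀ j : Fin d, ∃ p : Psub d F (bigGaps x j),
      E (x j * d + j.val) + (p : Fin d → PowerSeries F) ∈ M := by
    intro j
    obtain ⟨f, hf, hl⟩ := (hM (x j * d + j.val)).2 (by rw [idx_div, idx_mod])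
    set k := x j * d + j.val with hk
    obtain ⟨m, hm, p, hp, hp', hmp⟩ := hM.decomp (k + 1) ((cf k f)⁻¹ • f - E k) (by
      apply mem_Vge_succ
      · exact Submodule.sub_mem _ (Vge_smul _ hl.1) (lead_E k).1
      · rw [map_sub, map_smul, cf_E, if_pos rfl, smul_eq_mul, inv_mul_cancel₀ hl.2, sub_self])
    refine ⟨⟨p, ?_⟩, ?_⟩
    · intro l hlS
      by_cases hlk : l < k + 1
      · exact hp' l hlk
      · apply hp
        intro hg
        exact hlS (Finset.mem_filter.2 ⟨hg, by omega⟩)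
    · have : E k + p = (cf k f)⁻¹ • f - m := by
        rw [eq_sub_iff_add_eq, add_assoc, add_comm p m, hmp, add_sub_cancel]
      rw [this]
      exact M.sub_mem ((M.restrictScalars F).smul_mem _ hf) hm
  choose p hp using hex
  refine ⟨p, (has_Phi x p).eq_of_le hM ?_⟩
  rw [Phi, Submodule.span_le]
  rintro _ ⟨j, rfl⟩
  exact hp j

/-- strata are parametrized by `Phi` -/
noncomputable def stratumEquiv (n : ℕ) :
    ((x : Finset.Nat.antidiagonalTuple d n) × (∀ j, Psub d F (bigGaps (x : Fin d → ℕ) j))) ≃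
    {M : Submodule (PowerSeries F) (Fin d → PowerSeries F) //
        Module.Finite F ((Fin d → PowerSeries F) ⧸ M) ∧
        Module.finrank F ((Fin d → PowerSeries F) ⧸ M) = n} :=
  Equiv.ofBijective (fun y => ⟨Phi y.1.1 y.2, by
    have h := (has_Phi y.1.1 y.2).finrank
    rw [Finset.Nat.mem_antidiagonalTuple.1 y.1.2] at h
    exact h⟩) (by
    constructor
    · rintro ⟨⟨x, hx⟩, p⟩ ⟨⟨y, hy⟩, p'⟩ h
      have h := congrArg Subtype.val h
      simp only at h
      have hxy : x = y := (has_Phi x p).unique (h ▸ has_Phi y p')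
      subst hxy
      rw [Phi_injective x h]
    · rintro ⟨M, hM, hn⟩
      obtain ⟨x, hx⟩ := exists_has M hM
      obtain ⟨p, hp⟩ := Phi_surjective x M hx
      refine ⟨⟨⟨x, Finset.Nat.mem_antidiagonalTuple.2 ?_⟩, p⟩, Subtype.ext hp⟩
      rw [← hn, hx.finrank.2])

end Aux
end Spiral

open Spiral in
/-- For every `n ≥ 0`, the set of `F_q[[T]]`-submodules `M` of `F_q[[T]]^d`
with `dim_{F_q}(F_q[[T]]^d / M) = n` is finite, and its cardinality equals
`Σ_{x ∈ ℕ^d, n(x) = n} q^{W(x)}` (the sum over tuples of size `n`). -/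
theorem statement2 (d : ℕ) (hd : 1 ≤ d) (Fq : Type*) [Field Fq] [Fintype Fq] (q : ℕ)
    (hq : Fintype.card Fq = q) (n : ℕ) :
    {M : Submodule (PowerSeries Fq) (Fin d → PowerSeries Fq) |
        Module.Finite Fq ((Fin d → PowerSeries Fq) ⧸ M) ∧
        Module.finrank Fq ((Fin d → PowerSeries Fq) ⧸ M) = n}.Finite ∧
    Nat.card {M : Submodule (PowerSeries Fq) (Fin d → PowerSeries Fq) //
        Module.Finite Fq ((Fin d → PowerSeries Fq) ⧸ M) ∧
        Module.finrank Fq ((Fin d → PowerSeries Fq) ⧸ M) = n} =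
      ∑ x ∈ Finset.Nat.antidiagonalTuple d n, q ^ weight x := by
  have : NeZero d := ⟨by omega⟩
  have hfin : ∀ S, Finite (Psub d Fq S) := fun S => Finite.of_equiv _ (Spiral.PEquiv S).toEquiv.symm
  constructor
  · exact Set.finite_coe_iff.1 (Finite.of_equiv _ (stratumEquiv n))
  · rw [← Nat.card_congr (stratumEquiv n), Nat.card_sigma]
    rw [Finset.sum_coe_sort (Finset.Nat.antidiagonalTuple d n)
      (fun x => Nat.card (∀ j, Psub d Fq (bigGaps x j)))]
    apply Finset.sum_congr rfl
    intro x _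
    rw [Nat.card_pi]
    simp only [card_Psub, hq]
    rw [Finset.prod_pow_eq_pow_sum, sum_card_bigGaps]
end

section
/- For every integer n ≥ 0, the set of F_q[[T]]-submodules M of F_q[[T]]^d with dim_{F_q}(F_q[[T]]^d / M) = n is finite, and its cardinality equals Σ_λ q^{|λ|}, where λ ranges over all partitions with at most n parts, each part of size at most d − 1 (that is, the Gaussian binomial coefficient [n+d−1 choose d−1]_q). -/
namespace Sub3

/-- multisets of `n` naturals, each at most `D` -/
def G : ℕ → ℕ → Finset (Multiset ℕ)
  | 0, n => {Multiset.replicate n 0}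
  | _ + 1, 0 => {0}
  | D + 1, n + 1 => (G (D + 1) n).image (fun s => 0 ::ₘ s) ∪
      (G D (n + 1)).image (fun s => s.map Nat.succ)

lemma mem_G (D n : ℕ) (s : Multiset ℕ) :
    s ∈ G D n ↔ s.card = n ∧ ∀ x ∈ s, x ≤ D := by
  induction D, n using G.induct generalizing s with
  | case1 n =>
    simp only [G, Finset.mem_singleton, Multiset.eq_replicate, Nat.le_zero]
  | case2 D =>
    simp only [G, Finset.mem_singleton, Multiset.card_eq_zero]
    constructor
    · rintro rfl; simp
    · exact fun h => h.1
  | case3 D n ih1 ih2 =>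
    simp only [G, Finset.mem_union, Finset.mem_image, ih1, ih2]
    constructor
    · rintro (⟨t, ⟨h1, h2⟩, rfl⟩ | ⟨t, ⟨h1, h2⟩, rfl⟩)
      · refine ⟨by simp [h1], ?_⟩
        intro x hx
        rcases Multiset.mem_cons.1 hx with rfl | hx
        · omega
        · exact h2 x hx
      · refine ⟨by simp [h1], ?_⟩
        intro x hx
        obtain ⟨y, hy, rfl⟩ := Multiset.mem_map.1 hx
        have := h2 y hy
        omega
    · rintro ⟨h1, h2⟩
      by_cases h0 : 0 ∈ s
      · left
        obtain ⟨t, rfl⟩ := Multiset.exists_cons_of_mem h0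
        refine ⟨t, ⟨by simpa using h1, fun x hx => h2 x (Multiset.mem_cons_of_mem hx)⟩, rfl⟩
      · right
        refine ⟨s.map Nat.pred, ⟨by simpa using h1, ?_⟩, ?_⟩
        · intro x hx
          obtain ⟨y, hy, rfl⟩ := Multiset.mem_map.1 hx
          have := h2 y hy
          simp only [Nat.pred_eq_sub_one]
          omega
        · rw [Multiset.map_map]
          conv_rhs => rw [← Multiset.map_id s]
          apply Multiset.map_congr rfl
          intro x hx
          have : x ≠ 0 := fun h => h0 (h ▸ hx)
          simp only [Function.comp, Nat.pred_eq_sub_one, id]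
          omega

/-- generating sum -/
def g (q D n : ℕ) : ℕ := ∑ s ∈ G D n, q ^ s.sum

lemma g_zero (q n : ℕ) : g q 0 n = 1 := by simp [g, G]

lemma g_succ_zero (q D : ℕ) : g q D 0 = 1 := by cases D <;> simp [g, G]

lemma sum_map_succ (s : Multiset ℕ) : (s.map Nat.succ).sum = s.sum + s.card := by
  induction s using Multiset.induction_on with
  | empty => simp
  | cons a s ih => simp only [Multiset.map_cons, Multiset.sum_cons, ih, Multiset.card_cons]; omega

lemma g_succ (q D n : ℕ) : g q (D + 1) (n + 1) = g q (D + 1) n + q ^ (n + 1) * g q D (n + 1) := by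
  unfold g
  rw [show G (D + 1) (n + 1) = (G (D + 1) n).image (fun s => 0 ::ₘ s) ∪
      (G D (n + 1)).image (fun s => s.map Nat.succ) by rw [G]]
  rw [Finset.sum_union, Finset.sum_image, Finset.sum_image, Finset.mul_sum]
  · congr 1
    · simp
    · apply Finset.sum_congr rfl
      intro s hs
      rw [mem_G] at hs
      rw [sum_map_succ, hs.1, pow_add, mul_comm]
  · exact fun a _ b _ h => Multiset.map_injective Nat.succ_injective h
  · intro a _ b _ h; simpa using h
  · rw [Finset.disjoint_left]
    intro s h1 h2
    obtain ⟨t, _, rfl⟩ := Finset.mem_image.1 h1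
    obtain ⟨u, _, h⟩ := Finset.mem_image.1 h2
    have : 0 ∈ u.map Nat.succ := by rw [h]; simp
    simp at this

lemma g_rec (q D n : ℕ) : g q (D + 1) n = ∑ j ∈ Finset.range (n + 1), g q D j * q ^ j := by
  induction n with
  | zero => simp [g_succ_zero]
  | succ n ih => rw [g_succ, ih, Finset.sum_range_succ _ (n + 1), mul_comm]

lemma card_part (D n k : ℕ) :
    Nat.card {P : Nat.Partition k // P.parts.card ≤ n ∧ ∀ p ∈ P.parts, p ≤ D} =
      ((G D n).filter (fun s => s.sum = k)).card := by
  rw [← Nat.card_eq_finsetCard]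
  have hf : ∀ s : Multiset ℕ, s.filter (· ≠ 0) + Multiset.replicate (s.card - (s.filter (· ≠ 0)).card) 0 = s := by
    intro s
    have h := Multiset.filter_add_not (fun x : ℕ => x ≠ 0) s
    have h2 : s.filter (fun x => ¬ (x ≠ 0)) =
        Multiset.replicate (s.card - (s.filter (· ≠ 0)).card) 0 := by
      rw [Multiset.eq_replicate]
      refine ⟨?_, fun x hx => by simpa using (Multiset.mem_filter.1 hx).2⟩
      have := congrArg Multiset.card h
      rw [Multiset.card_add] at this
      omega
    rw [← h2]
    exact h
  refine Nat.card_congr (Equiv.ofBijective (fun P => ⟨P.1.parts +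
    Multiset.replicate (n - P.1.parts.card) 0, ?_⟩) ⟨?_, ?_⟩)
  · rw [Finset.mem_filter, mem_G]
    refine ⟨⟨?_, ?_⟩, ?_⟩
    · have := P.2.1
      simp only [Multiset.card_add, Multiset.card_replicate]; omega
    · intro x hx
      rcases Multiset.mem_add.1 hx with hx | hx
      · exact P.2.2 x hx
      · rw [Multiset.eq_of_mem_replicate hx]; omega
    · simp [P.1.parts_sum]
  · rintro ⟨P, hP⟩ ⟨Q, hQ⟩ h
    have key : ∀ R : Nat.Partition k, ∀ m, (R.parts + Multiset.replicate m 0).filter (· ≠ 0) = R.parts := by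
      intro R m
      rw [Multiset.filter_add, Multiset.filter_eq_self.2 (fun x hx => (R.parts_pos hx).ne'),
        Multiset.filter_eq_nil.2, add_zero]
      intro a ha
      simpa using Multiset.eq_of_mem_replicate ha
    have h' := congrArg Subtype.val h
    have h'' := congrArg (Multiset.filter (· ≠ 0)) h'
    simp only [key] at h''
    exact Subtype.ext (Nat.Partition.ext h'')
  · rintro ⟨s, hs⟩
    rw [Finset.mem_filter, mem_G] at hs
    obtain ⟨⟨h1, h2⟩, h3⟩ := hs
    refine ⟨⟨Nat.Partition.ofSums k s h3, ?_, ?_⟩, ?_⟩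
    · rw [← h1]; exact Multiset.card_le_card (Multiset.filter_le _ _)
    · exact fun p hp => h2 p (Multiset.mem_of_le (Multiset.filter_le _ _) hp)
    · apply Subtype.ext
      have := hf s
      rw [h1] at this
      exact this

lemma sum_part (q D n : ℕ) :
    ∑ k ∈ Finset.range (n * D + 1),
        Nat.card {P : Nat.Partition k // P.parts.card ≤ n ∧ ∀ p ∈ P.parts, p ≤ D} * q ^ k
      = g q D n := by
  unfold g
  rw [← Finset.sum_fiberwise_of_maps_to (t := Finset.range (n * D + 1)) (g := Multiset.sum)]
  · apply Finset.sum_congr rfl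
    intro k _
    rw [card_part, Finset.sum_congr rfl (g := fun _ => q ^ k)]
    · simp
    · intro s hs
      rw [(Finset.mem_filter.1 hs).2]
  · intro s hs
    rw [mem_G] at hs
    have := Multiset.sum_le_card_nsmul s D hs.2
    rw [hs.1, smul_eq_mul] at this
    exact Finset.mem_range.2 (by omega)

end Sub3
namespace Sub3
open PowerSeries
set_option linter.unusedSectionVars false

variable {K : Type*} [Field K] {V : Type*} [AddCommGroup V] [Module K⟦X⟧ V] [Module K V]
  [IsScalarTower K K⟦X⟧ V]

/-- submodule built from the data -/
def N (M : Submodule K⟦X⟧ V) (m : ℕ) (v : V ⧸ M) : Submodule K⟦X⟧ (V × K⟦X⟧) where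
  carrier := {p | ∃ s : K⟦X⟧, p.2 = X ^ m * s ∧ M.mkQ p.1 = s • v}
  add_mem' := by
    rintro a b ⟨s, h1, h2⟩ ⟨t, h3, h4⟩
    refine ⟨s + t, ?_, ?_⟩
    · simp [h1, h3, mul_add]
    · rw [Prod.fst_add, map_add, h2, h4, add_smul]
  zero_mem' := ⟨0, by simp, by simp⟩
  smul_mem' := by
    rintro c a ⟨s, h1, h2⟩
    refine ⟨c * s, ?_, ?_⟩
    · simp only [Prod.smul_snd, h1, smul_eq_mul]; ring
    · rw [Prod.smul_fst, map_smul, h2, mul_smul]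

lemma mem_N {M : Submodule K⟦X⟧ V} {m : ℕ} {v : V ⧸ M} {p : V × K⟦X⟧} :
    p ∈ N M m v ↔ ∃ s : K⟦X⟧, p.2 = X ^ m * s ∧ M.mkQ p.1 = s • v := Iff.rfl

/-- division by `X^m` -/
noncomputable def dv (m : ℕ) : K⟦X⟧ →ₗ[K] K⟦X⟧ where
  toFun r := PowerSeries.mk fun k => coeff (k + m) r
  map_add' _ _ := by ext; simp
  map_smul' _ _ := by ext; simp

/-- remainder mod `X^m` -/
noncomputable def rm (m : ℕ) : K⟦X⟧ →ₗ[K] (Fin m → K) where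
  toFun r i := coeff (i : ℕ) r
  map_add' _ _ := by ext; simp
  map_smul' _ _ := by ext; simp

lemma dv_mul (m : ℕ) (s : K⟦X⟧) : dv m (X ^ m * s) = s := by
  ext k; simp [dv, coeff_X_pow_mul]

lemma rm_eq (m : ℕ) (r : K⟦X⟧) (h : rm m r = 0) : r = X ^ m * dv m r := by
  ext k
  rw [coeff_X_pow_mul']
  split_ifs with hk
  · simp [dv, Nat.sub_add_cancel hk]
  · exact congrFun h ⟨k, not_le.1 hk⟩

lemma rm_mul (m : ℕ) (s : K⟦X⟧) : rm m (X ^ m * s) = 0 := by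
  ext i
  have := i.2
  simp only [rm, LinearMap.coe_mk, AddHom.coe_mk, coeff_X_pow_mul', Pi.zero_apply]
  rw [if_neg (by omega)]

lemma rm_surj (m : ℕ) (f : Fin m → K) : ∃ r, rm m r = f :=
  ⟨PowerSeries.mk fun k => if h : k < m then f ⟨k, h⟩ else 0, by ext i; simp [rm]⟩

/-- the linear map with kernel `N` -/
noncomputable def ph (M : Submodule K⟦X⟧ V) (m : ℕ) (v : V ⧸ M) :
    (V × K⟦X⟧) →ₗ[K] (V ⧸ M) × (Fin m → K) :=
  LinearMap.prod
    ((M.mkQ.restrictScalars K).comp (LinearMap.fst K V K⟦X⟧) -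
      (((LinearMap.toSpanSingleton K⟦X⟧ (V ⧸ M) v).restrictScalars K).comp (dv m)).comp
        (LinearMap.snd K V K⟦X⟧))
    ((rm m).comp (LinearMap.snd K V K⟦X⟧))

lemma ph_apply (M : Submodule K⟦X⟧ V) (m : ℕ) (v : V ⧸ M) (p : V × K⟦X⟧) :
    ph M m v p = (M.mkQ p.1 - dv m p.2 • v, rm m p.2) := rfl

lemma ker_ph (M : Submodule K⟦X⟧ V) (m : ℕ) (v : V ⧸ M) :
    LinearMap.ker (ph M m v) = (N M m v).restrictScalars K := by
  ext p
  rw [LinearMap.mem_ker, ph_apply, Submodule.restrictScalars_mem, mem_N, Prod.mk_eq_zero]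
  constructor
  · rintro ⟨h1, h2⟩
    exact ⟨dv m p.2, rm_eq m _ h2, sub_eq_zero.1 h1⟩
  · rintro ⟨s, h1, h2⟩
    rw [h1, dv_mul, rm_mul, h2, sub_self]
    exact ⟨rfl, rfl⟩

lemma ph_surj (M : Submodule K⟦X⟧ V) (m : ℕ) (v : V ⧸ M) : Function.Surjective (ph M m v) := by
  rintro ⟨w, f⟩
  obtain ⟨r, rfl⟩ := rm_surj m f
  obtain ⟨x, hx⟩ := M.mkQ_surjective (w + dv m r • v)
  exact ⟨(x, r), by rw [ph_apply, hx]; simp⟩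

/-- the quotient -/
noncomputable def eN (M : Submodule K⟦X⟧ V) (m : ℕ) (v : V ⧸ M) :
    ((V × K⟦X⟧) ⧸ N M m v) ≃ₗ[K] (V ⧸ M) × (Fin m → K) :=
  (Submodule.Quotient.restrictScalarsEquiv K (N M m v)).symm.trans
    ((Submodule.quotEquivOfEq _ _ (ker_ph M m v).symm).trans
      ((ph M m v).quotKerEquivOfSurjective (ph_surj M m v)))

lemma N_inj {M M' : Submodule K⟦X⟧ V} {m m' : ℕ} {v : V ⧸ M} {v' : V ⧸ M'}
    (h : N M m v = N M' m' v') : m = m' ∧ M = M' ∧ HEq v v' := by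
  have aux : ∀ {M M' : Submodule K⟦X⟧ V} {m m' : ℕ} {v : V ⧸ M} {v' : V ⧸ M'},
      N M m v = N M' m' v' → m' ≤ m ∧ M ≤ M' := by
    intro M M' m m' v v' h
    constructor
    · obtain ⟨x, hx⟩ := M.mkQ_surjective v
      have h1 : (x, X ^ m) ∈ N M m v := ⟨1, by simp, by simp [← hx]⟩
      rw [h] at h1
      obtain ⟨s, hs, -⟩ := h1
      exact (pow_dvd_pow_iff X_ne_zero X_prime.not_isUnit).1 ⟨s, hs⟩
    · intro x hx
      have h1 : (x, 0) ∈ N M m v := ⟨0, by simp, by simpa using hx⟩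
      rw [h] at h1
      obtain ⟨s, hs, h2⟩ := h1
      have : s = 0 := by
        rcases mul_eq_zero.1 hs.symm with h | h
        · exact absurd h (pow_ne_zero _ X_ne_zero)
        · exact h
      simpa [this] using h2
  obtain rfl : m = m' := le_antisymm (aux h.symm).1 (aux h).1
  obtain rfl : M = M' := le_antisymm (aux h).2 (aux h.symm).2
  refine ⟨rfl, rfl, heq_of_eq ?_⟩
  obtain ⟨x, hx⟩ := M.mkQ_surjective v
  have h1 : (x, X ^ m) ∈ N M m v := ⟨1, by simp, by simp [← hx]⟩
  rw [h] at h1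
  obtain ⟨s, hs, h2⟩ := h1
  have : s = 1 := by
    apply mul_left_cancel₀ (pow_ne_zero m (X_ne_zero (R := K)))
    rw [← hs, mul_one]
  rw [← hx, h2, this, one_smul]

lemma not_fin : ¬ Module.Finite K K⟦X⟧ := by
  intro h
  have h1 := LinearMap.finrank_le_finrank_of_surjective
    (f := rm (K := K) (Module.finrank K K⟦X⟧ + 1)) (fun f => rm_surj _ f)
  rw [Module.finrank_fin_fun] at h1
  omega

lemma N_surj (M : Submodule K⟦X⟧ (V × K⟦X⟧)) (hM : Module.Finite K ((V × K⟦X⟧) ⧸ M)) :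
    ∃ (M' : Submodule K⟦X⟧ V) (m : ℕ) (v : V ⧸ M'), Module.Finite K (V ⧸ M') ∧ M = N M' m v := by
  have hne : M.map (LinearMap.snd K⟦X⟧ V K⟦X⟧) ≠ ⊥ := by
    intro hb
    apply not_fin (K := K)
    have hle : M ≤ LinearMap.ker (LinearMap.snd K⟦X⟧ V K⟦X⟧) := by
      exact LinearMap.le_ker_iff_map.2 hb
    refine Module.Finite.of_surjective ((M.liftQ _ hle).restrictScalars K) ?_
    intro r
    exact ⟨M.mkQ (0, r), by simp⟩
  obtain ⟨m, hm⟩ := IsDiscreteValuationRing.ideal_eq_span_pow_irreducible (R := K⟦X⟧) hne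
    X_irreducible
  have h1 : (X ^ m : K⟦X⟧) ∈ M.map (LinearMap.snd K⟦X⟧ V K⟦X⟧) := by
    rw [hm]; exact Ideal.mem_span_singleton_self _
  obtain ⟨⟨x, y⟩, hx, hy⟩ := h1
  obtain rfl : y = X ^ m := hy
  have hin : Function.Injective
      (((M.comap (LinearMap.inl K⟦X⟧ V K⟦X⟧)).mapQ M (LinearMap.inl K⟦X⟧ V K⟦X⟧)
        le_rfl).restrictScalars K) := by
    rw [← LinearMap.ker_eq_bot, LinearMap.ker_eq_bot']
    intro a ha
    obtain ⟨b, rfl⟩ := Submodule.mkQ_surjective _ a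
    simp only [LinearMap.restrictScalars_apply, Submodule.mkQ_apply, Submodule.mapQ_apply,
      Submodule.Quotient.mk_eq_zero] at ha
    simpa using ha
  refine ⟨M.comap (LinearMap.inl K⟦X⟧ V K⟦X⟧), m, Submodule.mkQ _ x,
    Module.Finite.of_injective _ hin, ?_⟩
  ext ⟨a, r⟩
  rw [mem_N]
  have key : ∀ s : K⟦X⟧, (M.comap (LinearMap.inl K⟦X⟧ V K⟦X⟧)).mkQ a =
      s • (M.comap (LinearMap.inl K⟦X⟧ V K⟦X⟧)).mkQ x ↔ (a, X ^ m * s) ∈ M := by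
    intro s
    rw [← map_smul, ← sub_eq_zero, ← map_sub, ← LinearMap.mem_ker, Submodule.ker_mkQ,
      Submodule.mem_comap]
    have : (a, X ^ m * s) = LinearMap.inl K⟦X⟧ V K⟦X⟧ (a - s • x) + s • (x, X ^ m) := by
      ext <;> simp [mul_comm]
    rw [this, Submodule.add_mem_iff_left _ (M.smul_mem s hx)]
  constructor
  · intro h
    have h2 : r ∈ M.map (LinearMap.snd K⟦X⟧ V K⟦X⟧) := ⟨_, h, rfl⟩
    rw [hm] at h2
    obtain ⟨s, rfl⟩ := Ideal.mem_span_singleton.1 h2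
    exact ⟨s, rfl, (key s).2 h⟩
  · rintro ⟨s, h1, h2⟩
    simp only at h1 h2
    rw [h1]
    exact (key s).1 h2

variable (K V) in
/-- submodules of codimension `n` -/
abbrev S (n : ℕ) : Type _ := {M : Submodule K⟦X⟧ V //
  Module.Finite K (V ⧸ M) ∧ Module.finrank K (V ⧸ M) = n}

/-- the bijection -/
noncomputable def bij (n : ℕ) (t : Σ j : Fin (n + 1), Σ M : S K V j, V ⧸ M.1) : S K (V × K⟦X⟧) n :=
  ⟨N t.2.1.1 (n - t.1) t.2.2, by
    obtain ⟨j, ⟨M, h1, h2⟩, v⟩ := t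
    refine ⟨Module.Finite.equiv (eN M _ v).symm, ?_⟩
    have := j.2
    rw [(eN M _ v).finrank_eq, Module.finrank_prod, Module.finrank_fin_fun]
    change Module.finrank K (V ⧸ M) + (n - (j : ℕ)) = n
    omega⟩

lemma bij_bij (n : ℕ) : Function.Bijective (bij (K := K) (V := V) n) := by
  constructor
  · rintro ⟨⟨j, hj⟩, ⟨M, h1, h2⟩, v⟩ ⟨⟨j', hj'⟩, ⟨M', h1', h2'⟩, v'⟩ h
    obtain ⟨-, rfl, h4⟩ := N_inj (congrArg Subtype.val h)
    simp only at h2 h2' h4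
    subst h2
    subst h2'
    obtain rfl := eq_of_heq h4
    rfl
  · rintro ⟨M, h1, h2⟩
    obtain ⟨M', m, v, hf, rfl⟩ := N_surj M h1
    rw [(eN M' _ v).finrank_eq, Module.finrank_prod, Module.finrank_fin_fun] at h2
    refine ⟨⟨⟨Module.finrank K (V ⧸ M'), by omega⟩, ⟨M', hf, rfl⟩, v⟩, ?_⟩
    apply Subtype.ext
    simp only [bij]
    congr 1
    omega

lemma step [Fintype K] (hS : ∀ n, Finite (S K V n)) (n : ℕ) :
    Finite (S K (V × K⟦X⟧) n) ∧ Nat.card (S K (V × K⟦X⟧) n) =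
      ∑ j ∈ Finset.range (n + 1), Nat.card (S K V j) * Fintype.card K ^ j := by
  have hq : ∀ j : ℕ, ∀ M : S K V j, Finite (V ⧸ M.1) := fun j M => by
    have := M.2.1
    exact Module.finite_of_finite K
  have hc : ∀ j : ℕ, ∀ M : S K V j, Nat.card (V ⧸ M.1) = Fintype.card K ^ j := fun j M => by
    have := M.2.1
    rw [Module.natCard_eq_pow_finrank (K := K), M.2.2, Nat.card_eq_fintype_card]
  have e := Equiv.ofBijective _ (bij_bij (K := K) (V := V) n)
  refine ⟨Finite.of_equiv _ e, ?_⟩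
  rw [← Nat.card_congr e, Nat.card_sigma, Finset.sum_range]
  apply Finset.sum_congr rfl
  intro j _
  have := Fintype.ofFinite (S K V j)
  rw [Nat.card_sigma, Finset.sum_congr rfl (fun M _ => hc j M)]
  simp [Nat.card_eq_fintype_card]

/-- transport -/
lemma transport {W : Type*} [AddCommGroup W] [Module K⟦X⟧ W] [Module K W]
    [IsScalarTower K K⟦X⟧ W] (e : V ≃ₗ[K⟦X⟧] W) (n : ℕ) : Nonempty (S K V n ≃ S K W n) := by
  refine ⟨Equiv.subtypeEquiv (Submodule.orderIsoMapComap e).toEquiv ?_⟩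
  intro M
  have f : (V ⧸ M) ≃ₗ[K] (W ⧸ M.map (e : V →ₗ[K⟦X⟧] W)) :=
    (Submodule.Quotient.equiv M _ e rfl).restrictScalars K
  change _ ↔ Module.Finite K (W ⧸ M.map (e : V →ₗ[K⟦X⟧] W)) ∧
    Module.finrank K (W ⧸ M.map (e : V →ₗ[K⟦X⟧] W)) = n
  rw [f.finrank_eq, Module.Finite.equiv_iff f]

lemma base (n : ℕ) : Finite (S K (Fin 0 → K⟦X⟧) n) ∧
    Nat.card (S K (Fin 0 → K⟦X⟧) n) = if n = 0 then 1 else 0 := by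
  have hr : ∀ M : Submodule K⟦X⟧ (Fin 0 → K⟦X⟧), Module.finrank K ((Fin 0 → K⟦X⟧) ⧸ M) = 0 := by
    intro M
    have : Subsingleton ((Fin 0 → K⟦X⟧) ⧸ M) := M.mkQ_surjective.subsingleton
    exact Module.finrank_zero_of_subsingleton
  have hs : Subsingleton (S K (Fin 0 → K⟦X⟧) n) := ⟨fun a b => Subtype.ext (Subsingleton.elim _ _)⟩
  refine ⟨inferInstance, ?_⟩
  split_ifs with h
  · subst h
    have : Subsingleton ((Fin 0 → K⟦X⟧) ⧸ (⊥ : Submodule K⟦X⟧ (Fin 0 → K⟦X⟧))) :=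
      (Submodule.mkQ_surjective _).subsingleton
    have : Nonempty (S K (Fin 0 → K⟦X⟧) 0) := ⟨⟨⊥, inferInstance, hr ⊥⟩⟩
    exact Nat.card_eq_one_iff_unique.2 ⟨hs, this⟩
  · have : IsEmpty (S K (Fin 0 → K⟦X⟧) n) := ⟨fun a => h (a.2.2.symm.trans (hr a.1))⟩
    exact Nat.card_of_isEmpty

lemma stepFin [Fintype K] (d : ℕ) (hS : ∀ n, Finite (S K (Fin d → K⟦X⟧) n)) (n : ℕ) :
    Finite (S K (Fin (d + 1) → K⟦X⟧) n) ∧ Nat.card (S K (Fin (d + 1) → K⟦X⟧) n) =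
      ∑ j ∈ Finset.range (n + 1), Nat.card (S K (Fin d → K⟦X⟧) j) * Fintype.card K ^ j := by
  obtain ⟨h1, h2⟩ := step hS n
  obtain ⟨e⟩ := transport (K := K) ((LinearEquiv.prodComm K⟦X⟧ _ _).trans
    (Fin.consLinearEquiv K⟦X⟧ (fun _ : Fin (d + 1) => K⟦X⟧))) n
  exact ⟨Finite.of_equiv _ e, by rw [← Nat.card_congr e, h2]⟩

lemma main [Fintype K] (d : ℕ) (n : ℕ) :
    Finite (S K (Fin (d + 1) → K⟦X⟧) n) ∧
      Nat.card (S K (Fin (d + 1) → K⟦X⟧) n) = g (Fintype.card K) d n := by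
  induction d generalizing n with
  | zero =>
    obtain ⟨h1, h2⟩ := stepFin (K := K) 0 (fun n => (base n).1) n
    refine ⟨h1, ?_⟩
    rw [h2, g_zero]
    simp [(base _).2]
  | succ d ih =>
    obtain ⟨h1, h2⟩ := stepFin (K := K) (d + 1) (fun n => (ih n).1) n
    refine ⟨h1, ?_⟩
    rw [h2, g_rec]
    simp [(ih _).2]

end Sub3


/-- For every `n ≥ 0`, the set of `F_q[[T]]`-submodules `M` of `F_q[[T]]^d`
with `dim_{F_q}(F_q[[T]]^d / M) = n` is finite, and its cardinality equals `Σ_λ q^{|λ|}`,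
where `λ` ranges over all partitions with at most `n` parts, each part of size at most
`d − 1`. (Such partitions have `|λ| ≤ n(d-1)`, so the sum over `|λ| = k ≤ n(d-1)` below
is exactly the sum over all such partitions.) -/
theorem statement3 (d : ℕ) (hd : 1 ≤ d) (Fq : Type*) [Field Fq] [Fintype Fq] (q : ℕ)
    (hq : Fintype.card Fq = q) (n : ℕ) :
    {M : Submodule (PowerSeries Fq) (Fin d → PowerSeries Fq) |
        Module.Finite Fq ((Fin d → PowerSeries Fq) ⧸ M) ∧
        Module.finrank Fq ((Fin d → PowerSeries Fq) ⧸ M) = n}.Finite ∧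
    Nat.card {M : Submodule (PowerSeries Fq) (Fin d → PowerSeries Fq) //
        Module.Finite Fq ((Fin d → PowerSeries Fq) ⧸ M) ∧
        Module.finrank Fq ((Fin d → PowerSeries Fq) ⧸ M) = n} =
      ∑ k ∈ Finset.range (n * (d - 1) + 1),
        Nat.card {P : Nat.Partition k // P.parts.card ≤ n ∧ ∀ p ∈ P.parts, p ≤ d - 1} *
          q ^ k := by
  obtain ⟨d, rfl⟩ : ∃ e, d = e + 1 := ⟨d - 1, by omega⟩
  subst hq
  obtain ⟨h1, h2⟩ := Sub3.main (K := Fq) d n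
  refine ⟨Set.finite_coe_iff.1 h1, ?_⟩
  rw [Nat.add_sub_cancel, Sub3.sum_part]
  exact h2
end

section
/- The semigroup ℕ^d acts freely on ℕ^d via the spiral shifting operators: for every x ∈ ℕ^d and all a, b ∈ ℕ^d, if g^a(x) = g^b(x) then a = b, where g^a := g_1^{a_1} ∘ ⋯ ∘ g_d^{a_d}. -/
namespace Spiral

/-- The configuration `x` as a set of points of `[d] × ℕ`: the point `(i, n)` (seat `i`
0-indexed, level `n`) is encoded as the natural number `n*d + i`. The usual order on the
encodings is exactly the height order `≺` (height `h(i,n) = n + i/d`), and the spiral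
shift `δ + s/d` is encoded as `+ s`. -/
def pts (d : ℕ) (x : Fin d → ℕ) : Finset ℕ :=
  Finset.image (fun i : Fin d => x i * d + i.val) Finset.univ

/-- The points of `x` listed in increasing height order: `δ¹(x), …, δ^d(x)`. -/
def sortedPts (d : ℕ) (x : Fin d → ℕ) : List ℕ :=
  (pts d x).sort (· ≤ ·)

/-- The lowest point strictly above `p` (along the spiral) whose seat lies in `S`. -/
noncomputable def nextPt (d : ℕ) (S : Finset ℕ) (p : ℕ) : ℕ :=
  sInf {q : ℕ | p < q ∧ q % d ∈ S}

/-- The spiral shifting operator `g_j` (for `1 ≤ j ≤ d`): it fixes the lowest `j - 1`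
points `δ¹(x), …, δ^{j-1}(x)` and moves each remaining point `δ^k(x)` (`k ≥ j`) to
`δ^k(x) + s_k/d`, where `s_k` is the minimal positive integer such that the seat of
`δ^k(x) + s_k/d` lies in `{i(δ^j(x)), …, i(δ^d(x))}`. The resulting configuration is read
off from the new point set (which has exactly one point per seat). -/
noncomputable def gOp (d : ℕ) (j : ℕ) (x : Fin d → ℕ) : Fin d → ℕ := fun i =>
  let L := sortedPts d x
  let low := L.take (j - 1)
  let high := L.drop (j - 1)
  let S : Finset ℕ := high.toFinset.image (· % d)
  let Q : Finset ℕ := low.toFinset ∪ (high.map (nextPt d S)).toFinset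
  ∑ q ∈ Q.filter (fun q => q % d = i.val), q / d

/-- `g^a := g₁^{a₁} ∘ ⋯ ∘ g_d^{a_d}` (here `a i` is the exponent of `g_{i+1}`). -/
noncomputable def gIter (d : ℕ) (a : Fin d → ℕ) (x : Fin d → ℕ) : Fin d → ℕ :=
  (List.finRange d).foldr (fun j y => (gOp d (j.val + 1))^[a j] y) x

/-- Seats used by the points of index `≥ j`. -/
def seatS (d j : ℕ) (x : Fin d → ℕ) : Finset ℕ :=
  ((sortedPts d x).drop j).toFinset.image (· % d)

lemma nextPt_mem {d : ℕ} (hd : 1 ≤ d) {S : Finset ℕ} {p : ℕ} (hp : p % d ∈ S) :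
    p < nextPt d S p ∧ nextPt d S p % d ∈ S := by
  have hne : {q : ℕ | p < q ∧ q % d ∈ S}.Nonempty := ⟨p + d, by
    refine ⟨by omega, ?_⟩
    simpa using hp⟩
  exact Nat.sInf_mem hne

lemma nextPt_le {d : ℕ} {S : Finset ℕ} {p q : ℕ} (h : p < q) (hq : q % d ∈ S) :
    nextPt d S p ≤ q := Nat.sInf_le ⟨h, hq⟩

lemma nextPt_strict {d : ℕ} (hd : 1 ≤ d) {S : Finset ℕ} {p q : ℕ} (h : p < q)
    (hq : q % d ∈ S) : nextPt d S p < nextPt d S q :=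
  lt_of_le_of_lt (nextPt_le h hq) (nextPt_mem hd hq).1

lemma nextPt_inj {d : ℕ} (hd : 1 ≤ d) {S : Finset ℕ} {p q : ℕ} (hp : p % d ∈ S)
    (hq : q % d ∈ S) (h : nextPt d S p = nextPt d S q) : p = q := by
  rcases lt_trichotomy p q with h1 | h1 | h1
  · have := nextPt_strict hd h1 hq; omega
  · exact h1
  · have := nextPt_strict hd h1 hp; omega

lemma nextPt_add {d : ℕ} (hd : 1 ≤ d) {S : Finset ℕ} {p : ℕ} (k : ℕ) (hp : p % d ∈ S) :
    nextPt d S (p + d * k) = nextPt d S p + d * k := by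
  have h1 := nextPt_mem hd hp
  have hp' : (p + d * k) % d ∈ S := by simpa using hp
  have h2 := nextPt_mem hd hp'
  apply le_antisymm
  · apply nextPt_le
    · omega
    · simpa using h1.2
  · have h3 : nextPt d S p ≤ nextPt d S (p + d * k) - d * k := by
      apply nextPt_le
      · omega
      · obtain ⟨r, hr⟩ : ∃ r, nextPt d S (p + d * k) = r + d * k :=
          ⟨nextPt d S (p + d * k) - d * k, by omega⟩
        have h4 := h2.2
        rw [hr] at h4 ⊢
        simpa using h4
    omega

lemma nextPt_mod_inj {d : ℕ} (hd : 1 ≤ d) {S : Finset ℕ} {p q : ℕ} (hp : p % d ∈ S)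
    (hq : q % d ∈ S) (h : nextPt d S p % d = nextPt d S q % d) : p % d = q % d := by
  wlog hle : nextPt d S p ≤ nextPt d S q generalizing p q
  · exact (this hq hp h.symm (by omega)).symm
  obtain ⟨k, hk⟩ := (Nat.modEq_iff_dvd' hle).1 h
  have : nextPt d S (p + d * k) = nextPt d S q := by
    rw [nextPt_add hd k hp]; omega
  have := nextPt_inj hd (by simpa using hp) hq this
  rw [← this]; simp

lemma pts_mod_inj {d : ℕ} {x : Fin d → ℕ} {p q : ℕ} (hp : p ∈ pts d x) (hq : q ∈ pts d x)
    (h : p % d = q % d) : p = q := by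
  simp only [pts, Finset.mem_image, Finset.mem_univ, true_and] at hp hq
  obtain ⟨i, rfl⟩ := hp
  obtain ⟨k, rfl⟩ := hq
  have : i = k := by
    ext
    simpa [Nat.add_mod, Nat.mod_eq_of_lt i.2, Nat.mod_eq_of_lt k.2] using h
  rw [this]

lemma pts_card (d : ℕ) (x : Fin d → ℕ) : (pts d x).card = d := by
  unfold pts
  rw [Finset.card_image_of_injective]
  · simp
  · intro i k h
    ext
    have := congrArg (· % d) h
    simpa [Nat.add_mod, Nat.mod_eq_of_lt i.2, Nat.mod_eq_of_lt k.2] using this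

lemma pts_inj {d : ℕ} {x y : Fin d → ℕ} (h : pts d x = pts d y) : x = y := by
  funext i
  have h1 : x i * d + i.val ∈ pts d x := Finset.mem_image_of_mem _ (Finset.mem_univ i)
  have h2 : y i * d + i.val ∈ pts d y := Finset.mem_image_of_mem _ (Finset.mem_univ i)
  rw [← h] at h2
  have h3 := pts_mod_inj h1 h2 (by simp [Nat.add_mod])
  have hd : 0 < d := lt_of_le_of_lt (Nat.zero_le _) i.2
  exact Nat.eq_of_mul_eq_mul_right hd (by omega)

lemma mem_sortedPts {d : ℕ} {x : Fin d → ℕ} {p : ℕ} : p ∈ sortedPts d x ↔ p ∈ pts d x := by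
  simp [sortedPts]

lemma sortedPts_length (d : ℕ) (x : Fin d → ℕ) : (sortedPts d x).length = d := by
  simp [sortedPts, pts_card]

lemma sortedPts_pairwise (d : ℕ) (x : Fin d → ℕ) : (sortedPts d x).Pairwise (· < ·) :=
  (Finset.sortedLT_sort _).pairwise

lemma sortedPts_inj {d : ℕ} {x y : Fin d → ℕ} (h : sortedPts d x = sortedPts d y) : x = y := by
  apply pts_inj
  ext p
  rw [← mem_sortedPts, h, mem_sortedPts]

lemma pts_read {d : ℕ} (hd : 1 ≤ d) (Q : Finset ℕ) (hc : Q.card = d)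
    (hm : ∀ p ∈ Q, ∀ q ∈ Q, p % d = q % d → p = q) :
    pts d (fun i => ∑ q ∈ Q.filter (fun q => q % d = i.val), q / d) = Q := by
  symm
  apply Finset.eq_of_subset_of_card_le
  · intro q hq
    refine Finset.mem_image.2 ⟨⟨q % d, Nat.mod_lt _ hd⟩, Finset.mem_univ _, ?_⟩
    have : Q.filter (fun r => r % d = q % d) = {q} := by
      ext r
      simp only [Finset.mem_filter, Finset.mem_singleton]
      constructor
      · rintro ⟨h1, h2⟩
        exact hm r h1 q hq h2
      · rintro rfl
        exact ⟨hq, rfl⟩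
    simp only [this, Finset.sum_singleton]
    exact Nat.div_add_mod' q d
  · rw [pts_card, hc]

/-- The list of points of `g_{j+1} x`. -/
noncomputable def newL (d j : ℕ) (x : Fin d → ℕ) : List ℕ :=
  (sortedPts d x).take j ++ ((sortedPts d x).drop j).map (nextPt d (seatS d j x))

lemma mod_mem_seatS {d j : ℕ} {x : Fin d → ℕ} {p : ℕ} (hp : p ∈ (sortedPts d x).drop j) :
    p % d ∈ seatS d j x :=
  Finset.mem_image_of_mem _ (List.mem_toFinset.2 hp)

lemma split_lt {d j : ℕ} {x : Fin d → ℕ} {p q : ℕ} (hp : p ∈ (sortedPts d x).take j)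
    (hq : q ∈ (sortedPts d x).drop j) : p < q := by
  have h := sortedPts_pairwise d x
  rw [← List.take_append_drop j (sortedPts d x), List.pairwise_append] at h
  exact h.2.2 p hp q hq

lemma mod_notMem_seatS {d j : ℕ} {x : Fin d → ℕ} {p : ℕ} (hp : p ∈ (sortedPts d x).take j) :
    p % d ∉ seatS d j x := by
  intro h
  obtain ⟨q, hq, hqp⟩ := Finset.mem_image.1 h
  rw [List.mem_toFinset] at hq
  have h1 := split_lt hp hq
  have := pts_mod_inj (mem_sortedPts.1 (List.mem_of_mem_drop hq))
    (mem_sortedPts.1 (List.mem_of_mem_take hp)) hqp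
  omega

lemma newL_pairwise {d : ℕ} (hd : 1 ≤ d) (j : ℕ) (x : Fin d → ℕ) :
    (newL d j x).Pairwise (· < ·) := by
  have h := sortedPts_pairwise d x
  rw [← List.take_append_drop j (sortedPts d x), List.pairwise_append] at h
  unfold newL
  rw [List.pairwise_append]
  refine ⟨h.1, ?_, ?_⟩
  · rw [List.pairwise_map]
    refine h.2.1.imp_of_mem ?_
    intro a b _ hb hab
    exact nextPt_strict hd hab (mod_mem_seatS hb)
  · intro p hp q hq
    obtain ⟨r, hr, rfl⟩ := List.mem_map.1 hq
    exact (split_lt hp hr).trans (nextPt_mem hd (mod_mem_seatS hr)).1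

lemma newL_mod_inj {d : ℕ} (hd : 1 ≤ d) (j : ℕ) (x : Fin d → ℕ) :
    ∀ p ∈ newL d j x, ∀ q ∈ newL d j x, p % d = q % d → p = q := by
  intro p hp q hq h
  unfold newL at hp hq
  rw [List.mem_append, List.mem_map] at hp hq
  rcases hp with hp | ⟨p', hp, rfl⟩ <;> rcases hq with hq | ⟨q', hq, rfl⟩
  · exact pts_mod_inj (mem_sortedPts.1 (List.mem_of_mem_take hp))
      (mem_sortedPts.1 (List.mem_of_mem_take hq)) h
  · exact absurd (h ▸ (nextPt_mem hd (mod_mem_seatS hq)).2) (mod_notMem_seatS hp)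
  · exact absurd (h ▸ (nextPt_mem hd (mod_mem_seatS hp)).2) (mod_notMem_seatS hq)
  · have h2 := nextPt_mod_inj hd (mod_mem_seatS hp) (mod_mem_seatS hq) h
    rw [pts_mod_inj (mem_sortedPts.1 (List.mem_of_mem_drop hp))
      (mem_sortedPts.1 (List.mem_of_mem_drop hq)) h2]

lemma newL_length (d j : ℕ) (x : Fin d → ℕ) : (newL d j x).length = d := by
  have h := congrArg List.length (List.take_append_drop j (sortedPts d x))
  rw [List.length_append, sortedPts_length] at h
  rw [newL, List.length_append, List.length_map, h]

lemma sortedPts_gOp {d : ℕ} (hd : 1 ≤ d) (j : ℕ) (x : Fin d → ℕ) :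
    sortedPts d (gOp d (j + 1) x) = newL d j x := by
  have hpw := newL_pairwise hd j x
  have hnd : (newL d j x).Nodup := hpw.imp (fun h => ne_of_lt h)
  have hg : gOp d (j + 1) x =
      fun i => ∑ q ∈ (newL d j x).toFinset.filter (fun q => q % d = i.val), q / d := by
    funext i
    simp only [gOp, newL, List.toFinset_append, Nat.add_sub_cancel, seatS]
  have hpts : pts d (gOp d (j + 1) x) = (newL d j x).toFinset := by
    rw [hg]
    apply pts_read hd
    · rw [List.toFinset_card_of_nodup hnd, newL_length]
    · intro p hp q hq
      exact newL_mod_inj hd j x p (List.mem_toFinset.1 hp) q (List.mem_toFinset.1 hq)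
  unfold sortedPts
  rw [hpts]
  exact (List.toFinset_sort (· ≤ ·) hnd).2 (hpw.imp (fun h => le_of_lt h))

/-- The point of index `k` (0-indexed). -/
def entry (d : ℕ) (x : Fin d → ℕ) (k : ℕ) : ℕ := (sortedPts d x).getD k 0

lemma entry_gOp_low {d : ℕ} (hd : 1 ≤ d) {j k : ℕ} (hk : k < j) (hj : j < d) (x : Fin d → ℕ) :
    entry d (gOp d (j + 1) x) k = entry d x k := by
  have hl := sortedPts_length d x
  unfold entry
  rw [sortedPts_gOp hd, newL]
  simp only [List.getD_eq_getElem?_getD]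
  rw [List.getElem?_append_left (by rw [List.length_take]; omega), List.getElem?_take_of_lt hk]

lemma entry_gOp_self {d : ℕ} (hd : 1 ≤ d) {j : ℕ} (hj : j < d) (x : Fin d → ℕ) :
    entry d x j < entry d (gOp d (j + 1) x) j := by
  have hl := sortedPts_length d x
  have hmem : (sortedPts d x)[j] ∈ (sortedPts d x).drop j := by
    rw [List.drop_eq_getElem_cons (by omega)]
    exact List.mem_cons_self
  have h1 := (nextPt_mem hd (mod_mem_seatS hmem)).1
  have h2 : entry d x j = (sortedPts d x)[j] := by
    simp [entry, List.getD_eq_getElem?_getD, hl, hj]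
  have h3 : entry d (gOp d (j + 1) x) j = nextPt d (seatS d j x) (sortedPts d x)[j] := by
    unfold entry
    rw [sortedPts_gOp hd, newL]
    simp only [List.getD_eq_getElem?_getD]
    rw [List.getElem?_append_right (by rw [List.length_take]; omega)]
    simp [List.length_take, hl, hj.le, hj]
  rw [h2, h3]
  exact h1

lemma map_inj_aux {f : ℕ → ℕ} : ∀ (l l' : List ℕ),
    (∀ a ∈ l, ∀ b ∈ l', f a = f b → a = b) → l.map f = l'.map f → l = l'
  | [], [], _, _ => rfl
  | [], _ :: _, _, h => by simp at h
  | _ :: _, [], _, h => by simp at h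
  | a :: l, b :: l', hf, h => by
    simp only [List.map_cons, List.cons.injEq] at h
    rw [hf a (by simp) b (by simp) h.1, map_inj_aux l l'
      (fun a ha b hb => hf a (by simp [ha]) b (by simp [hb])) h.2]

lemma mem_seatS_iff {d : ℕ} (hd : 1 ≤ d) (j : ℕ) (x : Fin d → ℕ) (r : ℕ) :
    r ∈ seatS d j x ↔ r < d ∧ ∀ p ∈ (sortedPts d x).take j, p % d ≠ r := by
  constructor
  · intro h
    refine ⟨?_, fun p hp hpr => mod_notMem_seatS hp (hpr ▸ h)⟩
    obtain ⟨q, _, rfl⟩ := Finset.mem_image.1 h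
    exact Nat.mod_lt _ hd
  · rintro ⟨hr, h⟩
    have h1 : x ⟨r, hr⟩ * d + r ∈ sortedPts d x :=
      mem_sortedPts.2 (Finset.mem_image.2 ⟨⟨r, hr⟩, Finset.mem_univ _, rfl⟩)
    have h2 : (x ⟨r, hr⟩ * d + r) % d = r := by
      simp [Nat.add_mod, Nat.mod_eq_of_lt hr]
    rw [← List.take_append_drop j (sortedPts d x), List.mem_append] at h1
    rcases h1 with h1 | h1
    · exact absurd h2 (h _ h1)
    · have := mod_mem_seatS h1
      rwa [h2] at this

lemma gOp_injective {d : ℕ} (hd : 1 ≤ d) (j : ℕ) : Function.Injective (gOp d (j + 1)) := by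
  intro x y h
  have h1 : newL d j x = newL d j y := by
    rw [← sortedPts_gOp hd, ← sortedPts_gOp hd, h]
  unfold newL at h1
  obtain ⟨ht, hm⟩ := List.append_inj h1 (by simp [sortedPts_length])
  have hS : seatS d j x = seatS d j y := by
    ext r
    rw [mem_seatS_iff hd, mem_seatS_iff hd, ht]
  rw [← hS] at hm
  have hdr := map_inj_aux _ _ (fun a ha b hb hab =>
    nextPt_inj hd (mod_mem_seatS ha) (hS ▸ mod_mem_seatS hb) hab) hm
  apply sortedPts_inj
  rw [← List.take_append_drop j (sortedPts d x), ht, hdr, List.take_append_drop]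

lemma entry_iter_low {d : ℕ} (hd : 1 ≤ d) {j k : ℕ} (hk : k < j) (hj : j < d) (n : ℕ)
    (x : Fin d → ℕ) : entry d ((gOp d (j + 1))^[n] x) k = entry d x k := by
  induction n with
  | zero => rfl
  | succ n ih => rw [Function.iterate_succ_apply', entry_gOp_low hd hk hj, ih]

lemma entry_iter_self {d : ℕ} (hd : 1 ≤ d) {j : ℕ} (hj : j < d) (n : ℕ)
    (x : Fin d → ℕ) : entry d x j + n ≤ entry d ((gOp d (j + 1))^[n] x) j := by
  induction n with
  | zero => simp
  | succ n ih =>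
    rw [Function.iterate_succ_apply']
    have := entry_gOp_self hd hj ((gOp d (j + 1))^[n] x)
    omega

lemma entry_foldr {d : ℕ} (hd : 1 ≤ d) (a x : Fin d → ℕ) (k : ℕ) (l : List (Fin d))
    (hl : ∀ i ∈ l, k < i.val) :
    entry d (l.foldr (fun j y => (gOp d (j.val + 1))^[a j] y) x) k = entry d x k := by
  induction l with
  | nil => rfl
  | cons i t ih =>
    rw [List.foldr_cons, entry_iter_low hd (hl i (by simp)) i.2]
    exact ih (fun m hm => hl m (by simp [hm]))

lemma step_aux {d : ℕ} (hd : 1 ≤ d) {j : ℕ} (hj : j < d) {m n : ℕ} {u v : Fin d → ℕ}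
    (he : entry d u j = entry d v j) (hmn : m ≤ n)
    (h : (gOp d (j + 1))^[m] u = (gOp d (j + 1))^[n] v) : m = n ∧ u = v := by
  obtain ⟨k, rfl⟩ := Nat.exists_eq_add_of_le hmn
  rw [Function.iterate_add_apply] at h
  have h1 := (gOp_injective hd j).iterate m h
  have h2 := entry_iter_self hd hj k v
  rw [← h1] at h2
  obtain rfl : k = 0 := by omega
  exact ⟨rfl, h1⟩

lemma main_aux {d : ℕ} (hd : 1 ≤ d) (a b x : Fin d → ℕ) (l : List (Fin d))
    (hl : l.Pairwise (· < ·))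
    (h : l.foldr (fun j y => (gOp d (j.val + 1))^[a j] y) x =
      l.foldr (fun j y => (gOp d (j.val + 1))^[b j] y) x) : ∀ j ∈ l, a j = b j := by
  induction l with
  | nil => simp
  | cons i t ih =>
    rw [List.pairwise_cons] at hl
    rw [List.foldr_cons, List.foldr_cons] at h
    have ha := entry_foldr hd a x i.val t (fun m hm => hl.1 m hm)
    have hb := entry_foldr hd b x i.val t (fun m hm => hl.1 m hm)
    have key : a i = b i ∧ t.foldr (fun j y => (gOp d (j.val + 1))^[a j] y) x =
        t.foldr (fun j y => (gOp d (j.val + 1))^[b j] y) x := by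
      rcases le_total (a i) (b i) with hab | hab
      · exact step_aux hd i.2 (ha.trans hb.symm) hab h
      · have := step_aux hd i.2 (hb.trans ha.symm) hab h.symm
        exact ⟨this.1.symm, this.2.symm⟩
    intro j hj
    rcases List.mem_cons.1 hj with rfl | hj
    · exact key.1
    · exact ih hl.2 key.2 j hj

end Spiral

open Spiral in
/-- The semigroup `ℕ^d` acts freely on `ℕ^d` via the spiral shifting
operators: for every `x ∈ ℕ^d` and all `a, b ∈ ℕ^d`, if `g^a(x) = g^b(x)` then `a = b`,
where `g^a := g₁^{a₁} ∘ ⋯ ∘ g_d^{a_d}`. -/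
theorem statement6 (d : ℕ) (hd : 1 ≤ d) (x : Fin d → ℕ) (a b : Fin d → ℕ)
    (h : gIter d a x = gIter d b x) : a = b := by
  funext j
  exact main_aux hd a b x (List.finRange d) (List.pairwise_lt_finRange d) h j
    (List.mem_finRange j)
end
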